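/- arXiv:math/0702042 — 2 statements merged into one kernel-verified Lean document; each statement's English description precedes it below -/
import Mathlib

section
/- If (λ₁,λ₂,λ₃,λ₄) ≠ (0,0,0,0), then the e₀-Killing spinor Φ₀ is not square-integrable on hyperbolic 3-space: the nonnegative function (r,θ,ψ) ↦ ‖Φ₀(r,θ,ψ)‖²_{ℂ⁴} · (sinh(κr)/κ)² · sin θ is not Lebesgue-integrable on (0,∞) × (0,π) × (0,2π). -/
open Complex MeasureTheory Real

/-- The `e₀`-Killing spinor `Φ₀` on hyperbolic 3-space in polar coordinates `(r, θ, ψ)`. -/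
noncomputable def Phi0 (κ : ℝ) (l₁ l₂ l₃ l₄ : ℂ) (r θ ψ : ℝ) : Fin 4 → ℂ :=
  ![(l₁ * Complex.exp (I * ψ / 2) * Real.sin (θ / 2) +
      l₂ * Complex.exp (-I * ψ / 2) * Real.cos (θ / 2)) * Real.exp (-κ * r / 2),
    (l₂ * Complex.exp (-I * ψ / 2) * Real.sin (θ / 2) -
      l₁ * Complex.exp (I * ψ / 2) * Real.cos (θ / 2)) * Real.exp (κ * r / 2),
    (l₃ * Complex.exp (I * ψ / 2) * Real.sin (θ / 2) +
      l₄ * Complex.exp (-I * ψ / 2) * Real.cos (θ / 2)) * Real.exp (κ * r / 2),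
    (l₄ * Complex.exp (-I * ψ / 2) * Real.sin (θ / 2) -
      l₃ * Complex.exp (I * ψ / 2) * Real.cos (θ / 2)) * Real.exp (-κ * r / 2)]

lemma pair_norm (a b u v : ℂ) (s c : ℝ) (hu : ‖u‖ = 1) (huv : ‖v‖ = 1) (hsc : s ^ 2 + c ^ 2 = 1) :
    ‖a * u * s + b * v * c‖ ^ 2 + ‖b * v * s - a * u * c‖ ^ 2 = ‖a‖ ^ 2 + ‖b‖ ^ 2 := by
  have ha : ‖a‖ ^ 2 = ‖a * u‖ ^ 2 := by rw [norm_mul, hu, mul_one]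
  have hb : ‖b‖ ^ 2 = ‖b * v‖ ^ 2 := by rw [norm_mul, huv, mul_one]
  rw [ha, hb]
  generalize a * u = p
  generalize b * v = q
  simp only [← Complex.normSq_eq_norm_sq, Complex.normSq_apply, Complex.add_re, Complex.add_im,
    Complex.sub_re, Complex.sub_im, Complex.re_mul_ofReal, Complex.im_mul_ofReal]
  linear_combination (p.re * p.re + p.im * p.im + q.re * q.re + q.im * q.im) * hsc

lemma sum_lower (κ : ℝ) (hκ : 0 < κ) (l₁ l₂ l₃ l₄ : ℂ) (r θ ψ : ℝ) (hr : 0 ≤ r) :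
    (‖l₁‖ ^ 2 + ‖l₂‖ ^ 2 + ‖l₃‖ ^ 2 + ‖l₄‖ ^ 2) * Real.exp (-(κ * r)) ≤
      ∑ i : Fin 4, ‖Phi0 κ l₁ l₂ l₃ l₄ r θ ψ i‖ ^ 2 := by
  have hu : ‖Complex.exp (I * ψ / 2)‖ = 1 := by
    rw [Complex.norm_exp]; simp
  have hv : ‖Complex.exp (-I * ψ / 2)‖ = 1 := by
    rw [Complex.norm_exp]; simp
  have h1 := pair_norm l₁ l₂ _ _ _ _ hu hv (Real.sin_sq_add_cos_sq (θ / 2))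
  have h2 := pair_norm l₃ l₄ _ _ _ _ hu hv (Real.sin_sq_add_cos_sq (θ / 2))
  have e1 : ‖(Real.exp (-κ * r / 2) : ℂ)‖ ^ 2 = Real.exp (-(κ * r)) := by
    rw [Complex.norm_real, Real.norm_eq_abs, sq_abs, sq, ← Real.exp_add]; ring_nf
  have e2 : ‖(Real.exp (κ * r / 2) : ℂ)‖ ^ 2 = Real.exp (κ * r) := by
    rw [Complex.norm_real, Real.norm_eq_abs, sq_abs, sq, ← Real.exp_add]; ring_nf
  have e3 : Real.exp (-(κ * r)) ≤ Real.exp (κ * r) := by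
    apply Real.exp_le_exp.2
    have := mul_nonneg hκ.le hr
    linarith
  rw [Fin.sum_univ_four]
  simp only [Phi0, Matrix.cons_val, norm_mul (_ + _), norm_mul (_ - _), mul_pow, e1, e2]
  generalize ‖l₁ * Complex.exp (I * ψ / 2) * Real.sin (θ / 2) +
      l₂ * Complex.exp (-I * ψ / 2) * Real.cos (θ / 2)‖ = A at *
  generalize ‖l₂ * Complex.exp (-I * ψ / 2) * Real.sin (θ / 2) -
      l₁ * Complex.exp (I * ψ / 2) * Real.cos (θ / 2)‖ = B at *
  generalize ‖l₃ * Complex.exp (I * ψ / 2) * Real.sin (θ / 2) +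
      l₄ * Complex.exp (-I * ψ / 2) * Real.cos (θ / 2)‖ = C at *
  generalize ‖l₄ * Complex.exp (-I * ψ / 2) * Real.sin (θ / 2) -
      l₃ * Complex.exp (I * ψ / 2) * Real.cos (θ / 2)‖ = D at *
  have hB := mul_le_mul_of_nonneg_left e3 (sq_nonneg B)
  have hC := mul_le_mul_of_nonneg_left e3 (sq_nonneg C)
  have : ‖l₁‖ ^ 2 + ‖l₂‖ ^ 2 + ‖l₃‖ ^ 2 + ‖l₄‖ ^ 2 = A ^ 2 + B ^ 2 + C ^ 2 + D ^ 2 := by linarith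
  rw [this]
  linarith

lemma sinh_lower (x : ℝ) (hx : 2 ≤ x) : 1 / 4 ≤ Real.exp (-x) * Real.sinh x ^ 2 := by
  have h1 : Real.exp x * Real.exp (-x) = 1 := by rw [← Real.exp_add]; simp
  have h2 := Real.add_one_le_exp x
  have h3 : Real.exp (-x) ≤ 1 := Real.exp_le_one_iff.2 (by linarith)
  have h4 := Real.exp_pos (-x)
  rw [Real.sinh_eq]
  have : Real.exp (-x) * ((Real.exp x - Real.exp (-x)) / 2) ^ 2 =
      (Real.exp x - 2 * Real.exp (-x) + Real.exp (-x) ^ 3) / 4 := by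
    linear_combination (Real.exp x - 2 * Real.exp (-x)) / 4 * h1
  rw [this]
  have := pow_pos h4 3
  linarith

/-- A nonzero `e₀`-Killing spinor is not square integrable on hyperbolic 3-space. -/
theorem e0Killing_not_squareIntegrable (κ : ℝ) (hκ : 0 < κ) (l₁ l₂ l₃ l₄ : ℂ)
    (h : ¬(l₁ = 0 ∧ l₂ = 0 ∧ l₃ = 0 ∧ l₄ = 0)) :
    ¬ IntegrableOn
      (fun p : ℝ × ℝ × ℝ =>
        (∑ i : Fin 4, ‖Phi0 κ l₁ l₂ l₃ l₄ p.1 p.2.1 p.2.2 i‖ ^ 2) *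
          (Real.sinh (κ * p.1) / κ) ^ 2 * Real.sin p.2.1)
      (Set.Ioi 0 ×ˢ Set.Ioo 0 π ×ˢ Set.Ioo 0 (2 * π)) volume := by
  intro hint
  have hπ := Real.pi_pos
  set N := ‖l₁‖ ^ 2 + ‖l₂‖ ^ 2 + ‖l₃‖ ^ 2 + ‖l₄‖ ^ 2 with hN
  have hNpos : 0 < N := by
    by_contra hc
    apply h
    have q1 := sq_nonneg ‖l₁‖
    have q2 := sq_nonneg ‖l₂‖
    have q3 := sq_nonneg ‖l₃‖
    have q4 := sq_nonneg ‖l₄‖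
    refine ⟨?_, ?_, ?_, ?_⟩ <;> rw [← norm_eq_zero, ← sq_eq_zero_iff] <;> linarith
  set S : Set (ℝ × ℝ × ℝ) :=
    Set.Ioi (2 / κ) ×ˢ Set.Ioo (π / 4) (π / 2) ×ˢ Set.Ioo 0 (2 * π) with hS
  have hSm : MeasurableSet S :=
    measurableSet_Ioi.prod (measurableSet_Ioo.prod measurableSet_Ioo)
  have hsub : S ⊆ Set.Ioi 0 ×ˢ Set.Ioo 0 π ×ˢ Set.Ioo 0 (2 * π) := by
    apply Set.prod_mono (Set.Ioi_subset_Ioi (by positivity))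
    apply Set.prod_mono (Set.Ioo_subset_Ioo (by positivity) (by linarith)) le_rfl
  have hint2 := hint.mono_set hsub
  have hconst : IntegrableOn (fun _ : ℝ × ℝ × ℝ => N * (1 / 4) / κ ^ 2 * (1 / 2)) S volume := by
    refine Integrable.mono' hint2 aestronglyMeasurable_const ?_
    filter_upwards [ae_restrict_mem hSm] with p hp
    obtain ⟨hr, ⟨ht1, ht2⟩, -⟩ := hp
    simp only [Set.mem_Ioi] at hr
    have hx : 2 < κ * p.1 := by rwa [div_lt_iff₀' hκ] at hr
    have hr0 : 0 ≤ p.1 := le_trans (by positivity) hr.le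
    have a1 := sum_lower κ hκ l₁ l₂ l₃ l₄ p.1 p.2.1 p.2.2 hr0
    have a2 := sinh_lower _ hx.le
    have a3 : 1 / 2 ≤ Real.sin p.2.1 := by
      refine le_trans ?_ (Real.mul_le_sin (by linarith) ht2.le)
      rw [div_mul_eq_mul_div, le_div_iff₀ hπ]
      linarith
    rw [Real.norm_of_nonneg (by positivity)]
    refine mul_le_mul ?_ a3 (by norm_num) (by positivity)
    rw [div_pow, ← mul_div_assoc (∑ i : Fin 4, ‖Phi0 κ l₁ l₂ l₃ l₄ p.1 p.2.1 p.2.2 i‖ ^ 2)]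
    refine div_le_div_of_nonneg_right ?_ (sq_nonneg κ)
    calc N * (1 / 4) ≤ N * (Real.exp (-(κ * p.1)) * Real.sinh (κ * p.1) ^ 2) :=
          mul_le_mul_of_nonneg_left a2 hNpos.le
      _ = (N * Real.exp (-(κ * p.1))) * Real.sinh (κ * p.1) ^ 2 := by ring
      _ ≤ _ := mul_le_mul_of_nonneg_right a1 (sq_nonneg (Real.sinh (κ * p.1)))
  have hvol : volume S = ⊤ := by
    rw [hS, Measure.volume_eq_prod, Measure.prod_prod, Measure.volume_eq_prod, Measure.prod_prod,
      Real.volume_Ioi, Real.volume_Ioo, Real.volume_Ioo]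
    apply ENNReal.top_mul
    apply mul_ne_zero <;> rw [Ne, ENNReal.ofReal_eq_zero, not_le] <;> linarith
  rw [integrableOn_const_iff (by finiteness)] at hconst
  rcases hconst with h0 | h0
  · have : 0 < N * (1 / 4) / κ ^ 2 * (1 / 2) := by positivity
    exact this.ne' (enorm_eq_zero.1 h0)
  · rw [hvol] at h0
    exact lt_irrefl _ h0
end

section
/- Let E₀, E₁, E₂, E₃ and P₀₂, P₀₃, P₁₂, P₁₃, P₂₂, P₂₃, P₃₂, P₃₃ be real numbers, and let Q be the Hermitian 4×4 complex matrix with rows: row 1 = (E₀+E₃, E₁−iE₂, −P₀₂+P₃₂−i(P₀₃+P₃₃), P₁₂−P₂₃−i(P₂₂−P₁₃)); row 2 = (E₁+iE₂, E₀−E₃, −P₁₂+P₂₃−i(P₂₂+P₁₃), P₀₂+P₃₂+i(P₀₃+P₃₃)); row 3 = (−P₀₂+P₃₂+i(P₀₃+P₃₃), −P₁₂+P₂₃+i(P₂₂+P₁₃), E₀+E₃, −E₁+iE₂); row 4 = (P₁₂−P₂₃+i(P₂₂−P₁₃), P₀₂+P₃₂−i(P₀₃+P₃₃), −E₁−iE₂,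 E₀−E₃). If Q is positive semidefinite, then E₀ ≥ √(E₁² + E₂² + E₃²). -/
open Complex Matrix
open scoped ComplexOrder

/-- The energy-momentum matrix of the second positive mass theorem. -/
noncomputable def Qmat2 (E₀ E₁ E₂ E₃ P₀₂ P₀₃ P₁₂ P₁₃ P₂₂ P₂₃ P₃₂ P₃₃ : ℝ) :
    Matrix (Fin 4) (Fin 4) ℂ :=
  !![E₀ + E₃, E₁ - I * E₂, -P₀₂ + P₃₂ - I * (P₀₃ + P₃₃), P₁₂ - P₂₃ - I * (P₂₂ - P₁₃);
     E₁ + I * E₂, E₀ - E₃, -P₁₂ + P₂₃ - I * (P₂₂ + P₁₃), P₀₂ + P₃₂ + I * (P₀₃ + P₃₃);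
     -P₀₂ + P₃₂ + I * (P₀₃ + P₃₃), -P₁₂ + P₂₃ + I * (P₂₂ + P₁₃), E₀ + E₃, -E₁ + I * E₂;
     P₁₂ - P₂₃ + I * (P₂₂ - P₁₃), P₀₂ + P₃₂ - I * (P₀₃ + P₃₃), -E₁ - I * E₂, E₀ - E₃]

/-- Positivity of the Lorentzian length of the hyperbolic mass vector: if the energy-momentum
matrix of the second positive mass theorem is positive semidefinite, then
`E₀ ≥ √(E₁² + E₂² + E₃²)`. -/
theorem hyperbolic_mass_positivity (E₀ E₁ E₂ E₃ P₀₂ P₀₃ P₁₂ P₁₃ P₂₂ P₂₃ P₃₂ P₃₃ : ℝ)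
    (hQ : (Qmat2 E₀ E₁ E₂ E₃ P₀₂ P₀₃ P₁₂ P₁₃ P₂₂ P₂₃ P₃₂ P₃₃).PosSemidef) :
    Real.sqrt (E₁ ^ 2 + E₂ ^ 2 + E₃ ^ 2) ≤ E₀ := by
  have h0 := hQ.diag_nonneg (i := 0)
  have h1 := hQ.diag_nonneg (i := 1)
  have hd := (hQ.submatrix ![(0 : Fin 4), 1]).det_nonneg
  rw [Matrix.det_fin_two] at hd
  simp [Qmat2] at h0 h1 hd
  have e0 : 0 ≤ E₀ + E₃ := by exact_mod_cast h0
  have e1 : 0 ≤ E₀ - E₃ := sub_nonneg.mpr (by exact_mod_cast h1)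
  have hd' := (Complex.le_def.mp hd).1
  simp at hd'
  apply Real.sqrt_le_iff.mpr
  constructor
  · linarith
  · nlinarith
end
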